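/- arXiv:1607.04026 — 2 statements merged into one kernel-verified Lean document; each statement's English description precedes it below -/
import Mathlib

section
/- Let H ⊆ ℝ be an open interval, let n ∈ ℕ with n ≥ 2, let ω = (1, x, …, x^{n−1}) be the n-dimensional polynomial positive Chebyshev system on H, and let f : H → ℝ. Then there exist ω-convex functions g, h : H → ℝ with f = g − h if and only if for every subinterval [a, b] ⊆ H the ω-variation V^ω_{[a,b]}(f) is finite. -/
/-- `Φ_ω(x₁,…,x_m) = det(ω_i(x_j))`. -/
noncomputable def Phi {m : ℕ} (ω : Fin m → ℝ → ℝ) (x : Fin m → ℝ) : ℝ :=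
  Matrix.det (Matrix.of fun i j => ω i (x j))

/-- `ω` is an `m`-dimensional positive Chebyshev system over `H`. -/
def IsPosChebyshev {m : ℕ} (ω : Fin m → ℝ → ℝ) (H : Set ℝ) : Prop :=
  ∀ x : Fin m → ℝ, (∀ i, x i ∈ H) → StrictMono x → 0 < Phi ω x

/-- `f` is convex with respect to the `m`-dimensional system `ω` on `S`. -/
def IsConvexWRT {m : ℕ} (ω : Fin m → ℝ → ℝ) (S : Set ℝ) (f : ℝ → ℝ) : Prop :=
  ∀ x : Fin (m + 1) → ℝ, (∀ i, x i ∈ S) → StrictMono x → 0 ≤ Phi (Fin.snoc ω f) x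

/-- The generalized divided difference `[x₁,…,x_k; f]_{ω⟨k⟩}`:
the numerator replaces the last function `ω_k` by `f`. -/
noncomputable def divDiff {k : ℕ} (ω : Fin k → ℝ → ℝ) (f : ℝ → ℝ) (x : Fin k → ℝ) : ℝ :=
  Phi (fun i => if (i : ℕ) + 1 = k then f else ω i) x / Phi ω x

open scoped ENNReal

/-- The `ω`-variation `V^ω_{[a,b]}(f)`: the supremum, over all partitions
`a = x₀ < x₁ < … < x_m = b` with `m ≥ n`, of
`∑_{i=0}^{m-n} |[x_{i+1},…,x_{i+n}; f]_ω - [x_i,…,x_{i+n-1}; f]_ω|`, valued in `[0, ∞]`. -/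
noncomputable def omegaVar {n : ℕ} (ω : Fin n → ℝ → ℝ) (f : ℝ → ℝ) (a b : ℝ) : ℝ≥0∞ :=
  ⨆ (m : ℕ) (_ : n ≤ m) (x : Fin (m + 1) → ℝ) (_ : StrictMono x) (_ : x 0 = a)
      (_ : x (Fin.last m) = b),
    ∑ i : Fin (m - n + 1),
      ENNReal.ofReal
        |divDiff ω f (fun t : Fin n =>
            x ⟨(i : ℕ) + 1 + (t : ℕ), by have := i.isLt; have := t.isLt; omega⟩)
          - divDiff ω f (fun t : Fin n =>
            x ⟨(i : ℕ) + (t : ℕ), by have := i.isLt; have := t.isLt; omega⟩)|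

/-- divided difference over a finite set of nodes -/
noncomputable def dd (f : ℝ → ℝ) (S : Finset ℝ) : ℝ :=
  ∑ x ∈ S, f x / ∏ y ∈ S.erase x, (x - y)

lemma dd_prod_ne (S : Finset ℝ) (x : ℝ) : ∏ y ∈ S.erase x, (x - y) ≠ 0 := by
  rw [Finset.prod_ne_zero_iff]
  intro y hy
  exact sub_ne_zero.2 (Finset.ne_of_mem_erase hy).symm

lemma dd_erase (f : ℝ → ℝ) (S : Finset ℝ) (a : ℝ) (ha : a ∈ S) :
    dd f (S.erase a) = ∑ x ∈ S, f x * (x - a) / ∏ y ∈ S.erase x, (x - y) := by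
  rw [← Finset.add_sum_erase S _ ha]
  simp only [sub_self, mul_zero, zero_div, zero_add]
  refine Finset.sum_congr rfl fun x hx => ?_
  have hxa : x ≠ a := Finset.ne_of_mem_erase hx
  have h1 : a ∈ S.erase x := Finset.mem_erase.2 ⟨hxa.symm, ha⟩
  rw [← Finset.mul_prod_erase (S.erase x) _ h1, Finset.erase_right_comm]
  have h2 := dd_prod_ne (S.erase a) x
  have h3 : x - a ≠ 0 := sub_ne_zero.2 hxa
  field_simp

lemma dd_exch (f : ℝ → ℝ) (S : Finset ℝ) (a b : ℝ) (ha : a ∈ S) (hb : b ∈ S) :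
    dd f (S.erase a) - dd f (S.erase b) = (b - a) * dd f S := by
  rw [dd_erase f S a ha, dd_erase f S b hb, ← Finset.sum_sub_distrib, dd, Finset.mul_sum]
  refine Finset.sum_congr rfl fun x _ => ?_
  ring

lemma dd_congr {f g : ℝ → ℝ} {S : Finset ℝ} (h : ∀ x ∈ S, f x = g x) : dd f S = dd g S :=
  Finset.sum_congr rfl fun x hx => by rw [h x hx]

lemma dd_sub (f g : ℝ → ℝ) (S : Finset ℝ) : dd (fun x => f x - g x) S = dd f S - dd g S := by
  simp only [dd, sub_div, Finset.sum_sub_distrib]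

lemma dd_poly (p : Polynomial ℝ) (n : ℕ) (hp : p.degree < n) (S : Finset ℝ)
    (hS : S.card = n + 1) : dd (fun x => p.eval x) S = 0 := by
  have h := Lagrange.coeff_eq_sum (s := S) (v := id) (Function.injective_id.injOn) (P := p)
    (by rw [hS]; exact hp.trans (by exact_mod_cast Nat.lt_succ_self n))
  rw [hS, Nat.add_sub_cancel, Polynomial.coeff_eq_zero_of_degree_lt hp] at h
  simpa [dd] using h.symm

lemma Phi_snoc (n : ℕ) (f : ℝ → ℝ) (x : Fin (n + 1) → ℝ) (hx : Function.Injective x) :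
    Phi (Fin.snoc (α := fun _ => ℝ → ℝ) (fun i : Fin n => fun t : ℝ => t ^ (i : ℕ)) f) x =
      dd f (Finset.univ.image x) * Phi (fun i : Fin (n + 1) => fun t : ℝ => t ^ (i : ℕ)) x := by
  classical
  set S := Finset.univ.image x with hS
  have hc : S.card = n + 1 := by
    rw [hS, Finset.card_image_of_injective _ hx]; simp
  set p := Lagrange.interpolate S id f with hp
  have hinj : Set.InjOn (id : ℝ → ℝ) S := Function.injective_id.injOn
  have hdeg : p.degree < S.card := Lagrange.degree_interpolate_lt _ hinj
  have hev : ∀ s ∈ S, p.eval s = f s := fun s hs =>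
    Lagrange.eval_interpolate_at_node f hinj hs
  have hco : p.coeff n = dd f S := by
    have h := Lagrange.coeff_eq_sum hinj hdeg
    rw [hc, Nat.add_sub_cancel] at h
    rw [h]
    exact Finset.sum_congr rfl fun s hs => by simp [hev s hs]
  set A : Matrix (Fin (n + 1)) (Fin (n + 1)) ℝ := Matrix.of fun i j => x j ^ (i : ℕ) with hA
  have key := Matrix.det_updateRow_sum A (Fin.last n) (fun k => p.coeff k)
  simp only [Fin.val_last, hco, smul_eq_mul] at key
  rw [Phi, Phi, ← key]
  congr 1
  ext i j
  refine Fin.lastCases ?_ (fun i => ?_) i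
  · simp only [Matrix.of_apply, Fin.snoc_last, Matrix.updateRow_self, Finset.sum_apply,
      Pi.smul_apply, smul_eq_mul, hA]
    rw [← hev (x j) (by simp [hS]), Polynomial.eval_eq_sum_range' (n := n + 1),
      Finset.sum_range]
    rw [hc] at hdeg
    by_cases h0 : p = 0
    · simp [h0]
    · exact (Polynomial.natDegree_lt_iff_degree_lt h0).2 hdeg
  · rw [Matrix.updateRow_ne (Fin.castSucc_lt_last i).ne]
    simp [hA]

lemma Phi_pos (n : ℕ) (x : Fin n → ℝ) (hx : StrictMono x) :
    0 < Phi (fun i : Fin n => fun t : ℝ => t ^ (i : ℕ)) x := by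
  have : Phi (fun i : Fin n => fun t : ℝ => t ^ (i : ℕ)) x = (Matrix.vandermonde x).det := by
    rw [← Matrix.det_transpose]; rfl
  rw [this, Matrix.det_vandermonde]
  refine Finset.prod_pos fun i _ => Finset.prod_pos fun j hj => ?_
  exact sub_pos.2 (hx (Finset.mem_Ioi.1 hj))

lemma isConvex_iff (n : ℕ) (H : Set ℝ) (g : ℝ → ℝ) :
    IsConvexWRT (fun i : Fin n => fun t : ℝ => t ^ (i : ℕ)) H g ↔
      ∀ S : Finset ℝ, S.card = n + 1 → (S : Set ℝ) ⊆ H → 0 ≤ dd g S := by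
  constructor
  · intro h S hS hSH
    have hm := (S.orderEmbOfFin hS).strictMono
    have := h (S.orderEmbOfFin hS) (fun i => hSH (S.orderEmbOfFin_mem hS i)) hm
    rw [Phi_snoc n g _ hm.injective, Finset.image_orderEmbOfFin_univ] at this
    exact nonneg_of_mul_nonneg_left this (Phi_pos _ _ hm)
  · intro h x hxH hx
    rw [Phi_snoc n g _ hx.injective]
    refine mul_nonneg (h _ ?_ ?_) (Phi_pos _ _ hx).le
    · rw [Finset.card_image_of_injective _ hx.injective]; simp
    · intro y hy
      simp only [Finset.coe_image, Finset.coe_univ, Set.image_univ, Set.mem_range] at hy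
      obtain ⟨i, rfl⟩ := hy
      exact hxH i

lemma divDiff_eq (n : ℕ) (hn : 1 ≤ n) (f : ℝ → ℝ) (x : Fin n → ℝ) (hx : StrictMono x) :
    divDiff (fun i : Fin n => fun t : ℝ => t ^ (i : ℕ)) f x = dd f (Finset.univ.image x) := by
  obtain ⟨k, rfl⟩ : ∃ k, n = k + 1 := ⟨n - 1, by omega⟩
  rw [divDiff, div_eq_iff (Phi_pos _ _ hx).ne', ← Phi_snoc k f x hx.injective]
  congr 1
  ext i t
  refine Fin.lastCases ?_ (fun i => ?_) i
  · simp
  · have := i.isLt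
    simp [this.ne]

/-- consecutive subsets of a finite set -/
def Cons (F S : Finset ℝ) : Prop :=
  S ⊆ F ∧ ∀ y ∈ F, ∀ a ∈ S, ∀ b ∈ S, a ≤ y → y ≤ b → y ∈ S

lemma nonneg_of_cons (n : ℕ) (hn : 1 ≤ n) (g : ℝ → ℝ) (F : Finset ℝ)
    (h : ∀ S, S.card = n + 1 → Cons F S → 0 ≤ dd g S) :
    ∀ (k : ℕ) (S : Finset ℝ), S.card = n + 1 → S ⊆ F →
      (F.filter fun y => ∃ a ∈ S, ∃ b ∈ S, a ≤ y ∧ y ≤ b).card = k → 0 ≤ dd g S := by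
  intro k
  induction k using Nat.strong_induction_on with
  | _ k ih =>
  intro S hS hSF hk
  by_cases hc : Cons F S
  · exact h S hS hc
  have hne : S.Nonempty := Finset.card_pos.1 (by omega)
  have : ∃ y ∈ F, y ∉ S ∧ ∃ a ∈ S, ∃ b ∈ S, a ≤ y ∧ y ≤ b := by
    by_contra hcon
    push Not at hcon
    refine hc ⟨hSF, fun y hy a ha b hb h1 h2 => ?_⟩
    by_contra hyS
    exact absurd h2 (not_le.2 (hcon y hy hyS a ha b hb h1))
  obtain ⟨y, hyF, hyS, a', ha', b', hb', hay', hyb'⟩ := this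
  set a := S.min' hne with hadef
  set b := S.max' hne with hbdef
  have ha : a ∈ S := S.min'_mem hne
  have hb : b ∈ S := S.max'_mem hne
  have hamin : ∀ s ∈ S, a ≤ s := fun s hs => S.min'_le s hs
  have hbmax : ∀ s ∈ S, s ≤ b := fun s hs => S.le_max' s hs
  have hay : a < y := lt_of_le_of_ne ((hamin a' ha').trans hay') (fun e => hyS (e ▸ ha))
  have hyb : y < b := lt_of_le_of_ne (hyb'.trans (hbmax b' hb')) (fun e => hyS (e ▸ hb))
  set T := insert y S with hT
  have hTy : T.erase y = S := Finset.erase_insert hyS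
  have haT : a ∈ T := Finset.mem_insert_of_mem ha
  have hbT : b ∈ T := Finset.mem_insert_of_mem hb
  have hyT : y ∈ T := Finset.mem_insert_self _ _
  have hTF : T ⊆ F := Finset.insert_subset hyF hSF
  have hTc : T.card = n + 2 := by rw [hT, Finset.card_insert_of_notMem hyS, hS]
  have e1 := dd_exch g T a y haT hyT
  have e2 := dd_exch g T y b hyT hbT
  rw [hTy] at e1 e2
  have hTm : ∀ s ∈ T, a ≤ s ∧ s ≤ b := by
    intro s hs
    rcases Finset.mem_insert.1 hs with rfl | hs
    · exact ⟨hay.le, hyb.le⟩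
    · exact ⟨hamin s hs, hbmax s hs⟩
  have sub : ∀ c ∈ S, (c = a ∨ c = b) → 0 ≤ dd g (T.erase c) := by
    intro c hcS hcc
    have hcT : c ∈ T := Finset.mem_insert_of_mem hcS
    refine ih _ ?_ (T.erase c) (by rw [Finset.card_erase_of_mem hcT, hTc]; rfl)
      ((Finset.erase_subset _ _).trans hTF) rfl
    rw [← hk]
    refine Finset.card_lt_card (Finset.ssubset_iff_of_subset ?_ |>.2 ⟨c, ?_, ?_⟩)
    · intro z hz
      simp only [Finset.mem_filter] at hz ⊢
      obtain ⟨hzF, u, hu, v, hv, h1, h2⟩ := hz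
      exact ⟨hzF, a, ha, b, hb, (hTm u (Finset.mem_of_mem_erase hu)).1.trans h1,
        h2.trans (hTm v (Finset.mem_of_mem_erase hv)).2⟩
    · simp only [Finset.mem_filter]
      exact ⟨hSF hcS, c, hcS, c, hcS, le_rfl, le_rfl⟩
    · simp only [Finset.mem_filter]
      rintro ⟨-, u, hu, v, hv, h1, h2⟩
      rcases hcc with rfl | rfl
      · exact Finset.ne_of_mem_erase hu (le_antisymm h1 (hTm u (Finset.mem_of_mem_erase hu)).1)
      · exact Finset.ne_of_mem_erase hv (le_antisymm (hTm v (Finset.mem_of_mem_erase hv)).2 h2)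
  have s1 := sub a ha (Or.inl rfl)
  have s2 := sub b hb (Or.inr rfl)
  have e3 : (b - a) * dd g S = (b - y) * dd g (T.erase a) + (y - a) * dd g (T.erase b) := by
    linear_combination (-(b - y)) * e1 + (y - a) * e2
  have h3 : 0 ≤ (b - a) * dd g S := by
    rw [e3]
    exact add_nonneg (mul_nonneg (by linarith) s1) (mul_nonneg (by linarith) s2)
  exact nonneg_of_mul_nonneg_right h3 (by linarith)

lemma dd_mono (n : ℕ) (g : ℝ → ℝ) (H : Set ℝ)
    (h : ∀ S : Finset ℝ, S.card = n + 1 → (S : Set ℝ) ⊆ H → 0 ≤ dd g S) (B : Finset ℝ)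
    (hB : B.card = n) (hBH : (B : Set ℝ) ⊆ H) :
    ∀ (k : ℕ) (A : Finset ℝ), (A \ B).card = k → A.card = n → (A : Set ℝ) ⊆ H →
      (∀ a ∈ A, a ∉ B → ∀ b ∈ B, b ∉ A → a < b) → dd g A ≤ dd g B := by
  intro k
  induction k with
  | zero =>
    intro A hk hA hAH _
    have : A ⊆ B := Finset.sdiff_eq_empty_iff_subset.1 (Finset.card_eq_zero.1 hk)
    rw [Finset.eq_of_subset_of_card_le this (by omega)]
  | succ k ih =>
    intro A hk hA hAH hlt
    obtain ⟨a, ha⟩ : (A \ B).Nonempty := Finset.card_pos.1 (by omega)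
    have hk2 : (B \ A).card = k + 1 := by
      have h1 := Finset.card_sdiff_add_card_inter A B
      have h2 := Finset.card_sdiff_add_card_inter B A
      rw [Finset.inter_comm] at h2
      omega
    obtain ⟨b, hb⟩ : (B \ A).Nonempty := Finset.card_pos.1 (by omega)
    rw [Finset.mem_sdiff] at ha hb
    have hab := hlt a ha.1 ha.2 b hb.1 hb.2
    set T := insert b A with hT
    have hTb : T.erase b = A := Finset.erase_insert hb.2
    have haT : a ∈ T := Finset.mem_insert_of_mem ha.1
    have hbT : b ∈ T := Finset.mem_insert_self _ _
    have hTc : T.card = n + 1 := by rw [hT, Finset.card_insert_of_notMem hb.2, hA]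
    have hTH : (T : Set ℝ) ⊆ H := by
      rw [hT, Finset.coe_insert]
      exact Set.insert_subset (hBH hb.1) hAH
    have e := dd_exch g T a b haT hbT
    rw [hTb] at e
    have h0 := mul_nonneg (sub_nonneg.2 hab.le) (h T hTc hTH)
    have := ih (T.erase a) ?_ ?_ ?_ ?_
    · linarith
    · have : T.erase a \ B = (A \ B).erase a := by
        ext z
        simp only [hT, Finset.mem_sdiff, Finset.mem_erase, Finset.mem_insert]
        constructor
        · rintro ⟨⟨h1, rfl | h2⟩, h3⟩
          · exact absurd hb.1 h3
          · exact ⟨h1, h2, h3⟩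
        · rintro ⟨h1, h2, h3⟩
          exact ⟨⟨h1, Or.inr h2⟩, h3⟩
      rw [this, Finset.card_erase_of_mem (Finset.mem_sdiff.2 ha), hk]; rfl
    · rw [Finset.card_erase_of_mem haT, hTc]; rfl
    · exact (Finset.coe_subset.2 (Finset.erase_subset _ _)).trans hTH
    · intro u hu huB v hv hvT
      have huA : u ∈ A := by
        rcases Finset.mem_insert.1 (Finset.mem_of_mem_erase hu) with rfl | h2
        · exact absurd hb.1 huB
        · exact h2
      refine hlt u huA huB v hv fun hvA => hvT ?_
      refine Finset.mem_erase.2 ⟨fun e => ha.2 (e ▸ hv), Finset.mem_insert_of_mem hvA⟩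

lemma dd_update (g : ℝ → ℝ) (S : Finset ℝ) (z c : ℝ) (hz : z ∈ S) :
    ∃ v : ℝ, dd (Function.update g z v) S = c := by
  refine ⟨(c - ∑ x ∈ S.erase z, g x / ∏ y ∈ S.erase x, (x - y)) * ∏ y ∈ S.erase z, (z - y), ?_⟩
  rw [dd, ← Finset.add_sum_erase S _ hz]
  have h1 : ∑ x ∈ S.erase z, Function.update g z ((c - ∑ x ∈ S.erase z, g x / ∏ y ∈ S.erase x,
      (x - y)) * ∏ y ∈ S.erase z, (z - y)) x / ∏ y ∈ S.erase x, (x - y)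
      = ∑ x ∈ S.erase z, g x / ∏ y ∈ S.erase x, (x - y) :=
    Finset.sum_congr rfl fun x hx => by
      rw [Function.update_of_ne (Finset.ne_of_mem_erase hx)]
  rw [h1, Function.update_self, mul_div_assoc, div_self (dd_prod_ne S z)]
  ring

lemma exists_cons (n : ℕ) (c : Finset ℝ → ℝ) (F : Finset ℝ) :
    ∃ g : ℝ → ℝ, ∀ S, S.card = n + 1 → Cons F S → dd g S = c S := by
  induction F using Finset.induction_on_max with
  | empty =>
    refine ⟨0, fun S hS hc => ?_⟩
    rw [Finset.subset_empty.1 hc.1] at hS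
    simp at hS
  | insert z F hz ih =>
    obtain ⟨g, hg⟩ := ih
    have hold : ∀ v, ∀ S, S.card = n + 1 → Cons (insert z F) S → z ∉ S →
        dd (Function.update g z v) S = c S := by
      intro v S hS hc hzS
      rw [← hg S hS]
      · exact dd_congr fun x hx => Function.update_of_ne (fun e : x = z => hzS (e ▸ hx)) _ _
      · refine ⟨fun x hx => ?_, fun y hy => hc.2 y (Finset.mem_insert_of_mem hy)⟩
        rcases Finset.mem_insert.1 (hc.1 hx) with rfl | h
        · exact absurd hx hzS
        · exact h
    by_cases hex : ∃ S, S.card = n + 1 ∧ Cons (insert z F) S ∧ z ∈ S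
    · obtain ⟨S₀, hS₀, hc₀, hz₀⟩ := hex
      obtain ⟨v, hv⟩ := dd_update g S₀ z (c S₀) hz₀
      refine ⟨Function.update g z v, fun S hS hc => ?_⟩
      by_cases hzS : z ∈ S
      · have hle : ∀ x ∈ insert z F, x ≤ z := by
          intro x hx
          rcases Finset.mem_insert.1 hx with rfl | h
          · exact le_rfl
          · exact (hz x h).le
        have : S = S₀ := by
          by_cases hsub : S ⊆ S₀
          · exact Finset.eq_of_subset_of_card_le hsub (by omega)
          · obtain ⟨s, hs, hs0⟩ := Finset.not_subset.1 hsub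
            refine (Finset.eq_of_subset_of_card_le (fun x hx => ?_) (by omega)).symm
            refine hc.2 x (hc₀.1 hx) s hs z hzS ?_ (hle x (hc₀.1 hx))
            by_contra hlt
            exact hs0 (hc₀.2 s (hc.1 hs) x hx z hz₀ (not_le.1 hlt).le (hle s (hc.1 hs)))
        rw [this, hv]
      · exact hold v S hS hc hzS
    · refine ⟨Function.update g z 0, fun S hS hc => hold 0 S hS hc fun hzS => hex ⟨S, hS, hc, hzS⟩⟩

/-- window of consecutive values of a sequence -/
noncomputable def win (X : ℕ → ℝ) (n i : ℕ) : Finset ℝ :=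
  (Finset.range n).image fun t => X (i + t)

lemma mem_win {X : ℕ → ℝ} {n i : ℕ} {y : ℝ} : y ∈ win X n i ↔ ∃ t < n, X (i + t) = y := by
  simp [win]

lemma win_card {X : ℕ → ℝ} {m n i : ℕ} (hX : StrictMonoOn X (Set.Iic m)) (h : i + n ≤ m + 1) :
    (win X n i).card = n := by
  rw [win, Finset.card_image_of_injOn, Finset.card_range]
  intro s hs t ht hst
  simp only [Finset.coe_range, Set.mem_Iio] at hs ht
  have := hX.injOn (Set.mem_Iic.2 (by omega)) (Set.mem_Iic.2 (by omega)) hst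
  omega

lemma win_exch (f : ℝ → ℝ) {X : ℕ → ℝ} {m n i : ℕ} (hX : StrictMonoOn X (Set.Iic m))
    (h : i + n ≤ m) :
    dd f (win X n (i + 1)) - dd f (win X n i) = (X (i + n) - X i) * dd f (win X (n + 1) i) := by
  have h1 : (win X (n + 1) i).erase (X i) = win X n (i + 1) := by
    ext y
    simp only [Finset.mem_erase, mem_win]
    constructor
    · rintro ⟨hne, t, ht, rfl⟩
      have : t ≠ 0 := by rintro rfl; exact hne rfl
      exact ⟨t - 1, by omega, by congr 1; omega⟩
    · rintro ⟨t, ht, rfl⟩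
      refine ⟨?_, t + 1, by omega, by congr 1; omega⟩
      exact (hX (Set.mem_Iic.2 (by omega)) (Set.mem_Iic.2 (by omega)) (by omega)).ne'
  have h2 : (win X (n + 1) i).erase (X (i + n)) = win X n i := by
    ext y
    simp only [Finset.mem_erase, mem_win]
    constructor
    · rintro ⟨hne, t, ht, rfl⟩
      have : t ≠ n := by rintro rfl; exact hne rfl
      exact ⟨t, by omega, rfl⟩
    · rintro ⟨t, ht, rfl⟩
      refine ⟨?_, t, by omega, rfl⟩
      exact (hX (Set.mem_Iic.2 (by omega)) (Set.mem_Iic.2 (by omega)) (by omega)).ne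
  rw [← h1, ← h2]
  exact dd_exch f _ _ _ (mem_win.2 ⟨0, by omega, rfl⟩) (mem_win.2 ⟨n, by omega, rfl⟩)

lemma divDiff_win (m n i : ℕ) (hn : 1 ≤ n) (f : ℝ → ℝ) (X : ℕ → ℝ)
    (hX : StrictMonoOn X (Set.Iic m)) (h : i + n ≤ m + 1) (y : Fin n → ℝ)
    (hy : ∀ t : Fin n, y t = X (i + t)) :
    divDiff (fun i : Fin n => fun t : ℝ => t ^ (i : ℕ)) f y = dd f (win X n i) := by
  rw [divDiff_eq n hn f y]
  · congr 1
    ext z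
    simp only [Finset.mem_image, Finset.mem_univ, true_and, mem_win, hy]
    constructor
    · rintro ⟨t, rfl⟩; exact ⟨t, t.isLt, rfl⟩
    · rintro ⟨t, ht, rfl⟩; exact ⟨⟨t, ht⟩, rfl⟩
  · intro s t hst
    rw [hy, hy]
    have := s.isLt
    have := t.isLt
    have : (s : ℕ) < t := hst
    exact hX (Set.mem_Iic.2 (by omega)) (Set.mem_Iic.2 (by omega)) (by omega)

lemma sum_conv (m n : ℕ) (hn : 1 ≤ n) (hnm : n ≤ m) (f : ℝ → ℝ) (X : ℕ → ℝ)
    (hX : StrictMonoOn X (Set.Iic m)) (x : Fin (m + 1) → ℝ) (hx : ∀ k, x k = X k) :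
    ∑ i : Fin (m - n + 1),
      ENNReal.ofReal
        |divDiff (fun i : Fin n => fun t : ℝ => t ^ (i : ℕ)) f (fun t : Fin n =>
            x ⟨(i : ℕ) + 1 + (t : ℕ), by have := i.isLt; have := t.isLt; omega⟩)
          - divDiff (fun i : Fin n => fun t : ℝ => t ^ (i : ℕ)) f (fun t : Fin n =>
            x ⟨(i : ℕ) + (t : ℕ), by have := i.isLt; have := t.isLt; omega⟩)| =
    ENNReal.ofReal (∑ i ∈ Finset.range (m - n + 1),
      |dd f (win X n (i + 1)) - dd f (win X n i)|) := by
  rw [ENNReal.ofReal_sum_of_nonneg (fun _ _ => abs_nonneg _), Finset.sum_range]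
  refine Finset.sum_congr rfl fun i _ => ?_
  have := i.isLt
  rw [divDiff_win m n (i + 1) hn f X hX (by omega) _ (fun t => hx _),
    divDiff_win m n i hn f X hX (by omega) _ (fun t => hx _)]

lemma omegaVar_le (n : ℕ) (hn : 1 ≤ n) (f : ℝ → ℝ) (a b C : ℝ)
    (h : ∀ (m : ℕ) (X : ℕ → ℝ), n ≤ m → StrictMonoOn X (Set.Iic m) → X 0 = a → X m = b →
      ∑ i ∈ Finset.range (m - n + 1), |dd f (win X n (i + 1)) - dd f (win X n i)| ≤ C) :
    omegaVar (fun i : Fin n => fun t : ℝ => t ^ (i : ℕ)) f a b ≤ ENNReal.ofReal C := by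
  refine iSup_le fun m => iSup_le fun hnm => iSup_le fun x => iSup_le fun hx => iSup_le fun h0 =>
    iSup_le fun hl => ?_
  set X : ℕ → ℝ := fun k => if hk : k < m + 1 then x ⟨k, hk⟩ else 0 with hXdef
  have hxX : ∀ k, x k = X k := fun k => by
    simp only [hXdef, k.isLt, dif_pos, Fin.eta]
  have hX : StrictMonoOn X (Set.Iic m) := by
    intro s hs t ht hst
    have hs' : s < m + 1 := Nat.lt_succ_of_le hs
    have ht' : t < m + 1 := Nat.lt_succ_of_le ht
    simp only [hXdef, hs', ht', dif_pos]
    exact hx hst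
  rw [sum_conv m n hn hnm f X hX x hxX]
  refine ENNReal.ofReal_le_ofReal (h m X hnm hX ?_ ?_)
  · rw [← h0, hxX]; rfl
  · rw [← hl, hxX]; rfl

lemma le_omegaVar (n : ℕ) (hn : 1 ≤ n) (f : ℝ → ℝ) (a b : ℝ)
    (hV : omegaVar (fun i : Fin n => fun t : ℝ => t ^ (i : ℕ)) f a b ≠ ⊤)
    (m : ℕ) (X : ℕ → ℝ) (hnm : n ≤ m) (hX : StrictMonoOn X (Set.Iic m)) (h0 : X 0 = a)
    (hl : X m = b) :
    ∑ i ∈ Finset.range (m - n + 1), |dd f (win X n (i + 1)) - dd f (win X n i)| ≤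
      (omegaVar (fun i : Fin n => fun t : ℝ => t ^ (i : ℕ)) f a b).toReal := by
  rw [← ENNReal.ofReal_le_iff_le_toReal hV,
    ← sum_conv m n hn hnm f X hX (fun k => X k) (fun _ => rfl)]
  have hx : StrictMono (fun k : Fin (m + 1) => X k) := by
    intro s t hst
    have := s.isLt
    have := t.isLt
    exact hX (Set.mem_Iic.2 (by omega)) (Set.mem_Iic.2 (by omega)) hst
  unfold omegaVar
  exact le_iSup_of_le m <| le_iSup_of_le hnm <| le_iSup_of_le (fun k : Fin (m + 1) => X k) <|
    le_iSup_of_le hx <| le_iSup_of_le h0 <| le_iSup_of_le hl le_rfl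

lemma win_sub_Icc {X : ℕ → ℝ} {m n i : ℕ} (hX : StrictMonoOn X (Set.Iic m)) (h : i + n ≤ m + 1)
    {y : ℝ} (hy : y ∈ win X n i) : X 0 ≤ y ∧ y ≤ X m := by
  obtain ⟨t, ht, rfl⟩ := mem_win.1 hy
  exact ⟨hX.monotoneOn (Set.mem_Iic.2 (by omega)) (Set.mem_Iic.2 (by omega)) (by omega),
    hX.monotoneOn (Set.mem_Iic.2 (by omega)) (Set.mem_Iic.2 (by omega)) (by omega)⟩

lemma exists_below (H : Set ℝ) (hH : IsOpen H) (a : ℝ) (ha : a ∈ H) (n : ℕ) :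
    ∃ C : Finset ℝ, C.card = n ∧ (C : Set ℝ) ⊆ H ∧ ∀ c ∈ C, c < a := by
  have h1 : ∃ l < a, Set.Ioc l a ⊆ H := exists_Ioc_subset_of_mem_nhds (hH.mem_nhds ha) ⟨a - 1, by simp⟩
  obtain ⟨l, hl, hs⟩ := h1
  obtain ⟨C, hC, hc⟩ := (Set.Ioo_infinite hl).exists_subset_card_eq n
  exact ⟨C, hc, fun c hcC => hs ⟨(hC hcC).1, (hC hcC).2.le⟩, fun c hcC => (hC hcC).2⟩

lemma exists_above (H : Set ℝ) (hH : IsOpen H) (a : ℝ) (ha : a ∈ H) (n : ℕ) :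
    ∃ C : Finset ℝ, C.card = n ∧ (C : Set ℝ) ⊆ H ∧ ∀ c ∈ C, a < c := by
  have h1 : ∃ l, a < l ∧ Set.Ico a l ⊆ H := exists_Ico_subset_of_mem_nhds (hH.mem_nhds ha) ⟨a + 1, by simp⟩
  obtain ⟨l, hl, hs⟩ := h1
  obtain ⟨C, hC, hc⟩ := (Set.Ioo_infinite hl).exists_subset_card_eq n
  exact ⟨C, hc, fun c hcC => hs ⟨(hC hcC).1.le, (hC hcC).2⟩, fun c hcC => (hC hcC).1⟩

lemma convex_bound (H : Set ℝ) (hH : IsOpen H) (n : ℕ) (g : ℝ → ℝ)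
    (hg : ∀ S : Finset ℝ, S.card = n + 1 → (S : Set ℝ) ⊆ H → 0 ≤ dd g S)
    (a b : ℝ) (hab : a < b) (hI : Set.Icc a b ⊆ H) :
    ∃ C, ∀ (m : ℕ) (X : ℕ → ℝ), n ≤ m → StrictMonoOn X (Set.Iic m) → X 0 = a → X m = b →
      ∑ i ∈ Finset.range (m - n + 1), |dd g (win X n (i + 1)) - dd g (win X n i)| ≤ C := by
  obtain ⟨P, hPc, hPH, hPa⟩ := exists_below H hH a (hI ⟨le_rfl, hab.le⟩) n
  obtain ⟨Q, hQc, hQH, hQb⟩ := exists_above H hH b (hI ⟨hab.le, le_rfl⟩) n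
  refine ⟨dd g Q - dd g P, fun m X hnm hX h0 hl => ?_⟩
  have hsub : ∀ k i, i + k ≤ m + 1 → ((win X k i : Finset ℝ) : Set ℝ) ⊆ Set.Icc a b := by
    intro k i hi y hy
    have := win_sub_Icc hX hi hy
    rw [h0, hl] at this
    exact this
  have e : ∀ i ∈ Finset.range (m - n + 1), |dd g (win X n (i + 1)) - dd g (win X n i)| =
      dd g (win X n (i + 1)) - dd g (win X n i) := by
    intro i hi
    have hi' := Finset.mem_range.1 hi
    rw [abs_of_nonneg]
    rw [win_exch g hX (by omega)]
    refine mul_nonneg (sub_nonneg.2 ?_) (hg _ (win_card hX (by omega))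
      ((hsub _ _ (by omega)).trans hI))
    exact hX.monotoneOn (Set.mem_Iic.2 (by omega)) (Set.mem_Iic.2 (by omega)) (by omega)
  rw [Finset.sum_congr rfl e, Finset.sum_range_sub (fun i => dd g (win X n i))]
  have k1 := dd_mono n g H hg (win X n 0) (win_card hX (by omega))
    ((hsub _ _ (by omega)).trans hI) _ P rfl hPc hPH
    (fun p hp _ q hq _ => (hPa p hp).trans_le (hsub _ _ (by omega) hq).1)
  have k2 := dd_mono n g H hg Q hQc hQH _ (win X n (m - n + 1)) rfl (win_card hX (by omega))
    ((hsub _ _ (by omega)).trans hI)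
    (fun p hp _ q hq _ => (hsub _ _ (by omega) hp).2.trans_lt (hQb q hq))
  linarith

lemma finite_bound (n : ℕ) (hn : 1 ≤ n) (f g : ℝ → ℝ) (F : Finset ℝ)
    (hg : ∀ S, S.card = n + 1 → Cons F S → dd g S = max (dd f S) 0)
    (a b : ℝ) (ha : a ∈ F) (hb : b ∈ F)
    (hV : omegaVar (fun i : Fin n => fun t : ℝ => t ^ (i : ℕ)) f a b ≠ ⊤)
    (A B : Finset ℝ) (hA : A.card = n) (hB : B.card = n) (hAF : A ⊆ F) (hBF : B ⊆ F)
    (hA' : ∀ y ∈ A, a < y ∧ y < b) (hB' : ∀ y ∈ B, a < y ∧ y < b) :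
    |dd g A - dd g B| ≤ (omegaVar (fun i : Fin n => fun t : ℝ => t ^ (i : ℕ)) f a b).toReal := by
  obtain ⟨y₀, hy₀⟩ : A.Nonempty := Finset.card_pos.1 (by omega)
  have hab : a < b := (hA' y₀ hy₀).1.trans (hA' y₀ hy₀).2
  have hg0 : ∀ S : Finset ℝ, S.card = n + 1 → (S : Set ℝ) ⊆ (F : Set ℝ) → 0 ≤ dd g S :=
    fun S hS hSF => nonneg_of_cons n hn g F
      (fun S hS hc => by rw [hg S hS hc]; exact le_max_right _ _) _ S hS
      (Finset.coe_subset.1 hSF) rfl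
  set G := F.filter (fun y => a ≤ y ∧ y ≤ b) with hG
  have hGm : ∀ y, y ∈ G ↔ y ∈ F ∧ a ≤ y ∧ y ≤ b := fun y => by simp [hG]
  have haG : a ∈ G := (hGm a).2 ⟨ha, le_rfl, hab.le⟩
  have hbG : b ∈ G := (hGm b).2 ⟨hb, hab.le, le_rfl⟩
  have hcard : n + 1 ≤ G.card := by
    have h1 : a ∉ A := fun h => (hA' a h).1.false
    rw [← hA, ← Finset.card_insert_of_notMem h1]
    refine Finset.card_le_card (Finset.insert_subset haG fun y hy => ?_)
    exact (hGm y).2 ⟨hAF hy, (hA' y hy).1.le, (hA' y hy).2.le⟩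
  obtain ⟨m, hm⟩ : ∃ m, G.card = m + 1 := ⟨G.card - 1, by omega⟩
  have hnm : n ≤ m := by omega
  set e := G.orderEmbOfFin hm with he
  set X : ℕ → ℝ := fun k => if hk : k < m + 1 then e ⟨k, hk⟩ else 0 with hXdef
  have hXe : ∀ k (hk : k < m + 1), X k = e ⟨k, hk⟩ := fun k hk => dif_pos hk
  have hX : StrictMonoOn X (Set.Iic m) := by
    intro s hs t ht hst
    have hs' : s < m + 1 := Nat.lt_succ_of_le hs
    have ht' : t < m + 1 := Nat.lt_succ_of_le ht
    rw [hXe s hs', hXe t ht']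
    exact e.strictMono hst
  have hXG : ∀ k ≤ m, X k ∈ G := fun k hk => by
    rw [hXe k (by omega)]; exact G.orderEmbOfFin_mem hm _
  have hGX : ∀ y ∈ G, ∃ k ≤ m, X k = y := by
    intro y hy
    rw [← Finset.mem_coe, ← G.range_orderEmbOfFin hm] at hy
    obtain ⟨k, rfl⟩ := hy
    exact ⟨k, by have := k.isLt; omega, hXe k k.isLt⟩
  have hlt : ∀ p q, p ≤ m → q ≤ m → X p < X q → p < q := by
    intro p q hp hq h
    exact (hX.lt_iff_lt (Set.mem_Iic.2 hp) (Set.mem_Iic.2 hq)).1 h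
  have hle : ∀ p q, p ≤ m → q ≤ m → X p ≤ X q → p ≤ q := by
    intro p q hp hq h
    exact (hX.le_iff_le (Set.mem_Iic.2 hp) (Set.mem_Iic.2 hq)).1 h
  have h0 : X 0 = a := by
    obtain ⟨k, hk, hka⟩ := hGX a haG
    refine le_antisymm ?_ ((hGm _).1 (hXG 0 (by omega))).2.1
    rw [← hka]
    exact hX.monotoneOn (Set.mem_Iic.2 (by omega)) (Set.mem_Iic.2 hk) (by omega)
  have hl : X m = b := by
    obtain ⟨k, hk, hka⟩ := hGX b hbG
    refine le_antisymm ((hGm _).1 (hXG m le_rfl)).2.2 ?_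
    rw [← hka]
    exact hX.monotoneOn (Set.mem_Iic.2 hk) (Set.mem_Iic.2 le_rfl) hk
  have hwF : ∀ k i, i + k ≤ m + 1 → win X k i ⊆ F := by
    intro k i hi y hy
    obtain ⟨t, ht, rfl⟩ := mem_win.1 hy
    exact ((hGm _).1 (hXG _ (by omega))).1
  have hcons : ∀ k i, i + k ≤ m + 1 → Cons F (win X k i) := by
    intro k i hi
    refine ⟨hwF k i hi, fun y hy u hu v hv huy hyv => ?_⟩
    obtain ⟨s, hs, rfl⟩ := mem_win.1 hu
    obtain ⟨t, ht, rfl⟩ := mem_win.1 hv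
    have hyG : y ∈ G := (hGm y).2 ⟨hy, ((hGm _).1 (hXG (i + s) (by omega))).2.1.trans huy,
      hyv.trans ((hGm _).1 (hXG (i + t) (by omega))).2.2⟩
    obtain ⟨r, hr, rfl⟩ := hGX y hyG
    have h1 := hle _ _ (by omega) hr huy
    have h2 := hle _ _ hr (by omega) hyv
    exact mem_win.2 ⟨r - i, by omega, by congr 1; omega⟩
  have hsum : dd g (win X n (m - n + 1)) - dd g (win X n 0) ≤
      (omegaVar (fun i : Fin n => fun t : ℝ => t ^ (i : ℕ)) f a b).toReal := by
    refine le_trans ?_ (le_omegaVar n hn f a b hV m X hnm hX h0 hl)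
    rw [← Finset.sum_range_sub (fun i => dd g (win X n i))]
    refine Finset.sum_le_sum fun i hi => ?_
    have hi' := Finset.mem_range.1 hi
    rw [win_exch g hX (by omega), win_exch f hX (by omega),
      hg _ (win_card hX (by omega)) (hcons _ _ (by omega)), abs_mul]
    have h1 : 0 ≤ X (i + n) - X i := sub_nonneg.2
      (hX.monotoneOn (Set.mem_Iic.2 (by omega)) (Set.mem_Iic.2 (by omega)) (by omega))
    rw [abs_of_nonneg h1]
    exact mul_le_mul_of_nonneg_left (max_le (le_abs_self _) (abs_nonneg _)) h1
  have hboth : ∀ D : Finset ℝ, D.card = n → D ⊆ F → (∀ y ∈ D, a < y ∧ y < b) →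
      dd g (win X n 0) ≤ dd g D ∧ dd g D ≤ dd g (win X n (m - n + 1)) := by
    intro D hD hDF hD'
    have hDX : ∀ y ∈ D, ∃ k ≤ m, X k = y := fun y hy =>
      hGX y ((hGm y).2 ⟨hDF hy, (hD' y hy).1.le, (hD' y hy).2.le⟩)
    constructor
    · refine dd_mono n g F hg0 D hD (Finset.coe_subset.2 hDF) _ _ rfl (win_card hX (by omega))
        (Finset.coe_subset.2 (hwF _ _ (by omega))) ?_
      intro u hu _ v hv hvn
      obtain ⟨s, hs, rfl⟩ := mem_win.1 hu
      obtain ⟨r, hr, rfl⟩ := hDX v hv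
      have : n ≤ r := by
        by_contra hcon
        exact hvn (mem_win.2 ⟨r, by omega, by congr 1; omega⟩)
      exact hX (Set.mem_Iic.2 (by omega)) (Set.mem_Iic.2 (by omega)) (by omega)
    · refine dd_mono n g F hg0 _ (win_card hX (by omega))
        (Finset.coe_subset.2 (hwF _ _ (by omega))) _ D rfl hD (Finset.coe_subset.2 hDF) ?_
      intro v hv hvn u hu _
      obtain ⟨s, hs, rfl⟩ := mem_win.1 hu
      obtain ⟨r, hr, rfl⟩ := hDX v hv
      have : r < m - n + 1 := by
        by_contra hcon
        exact hvn (mem_win.2 ⟨r - (m - n + 1), by omega, by congr 1; omega⟩)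
      exact hX (Set.mem_Iic.2 (by omega)) (Set.mem_Iic.2 (by omega)) (by omega)
  have hA2 := hboth A hA hAF hA'
  have hB2 := hboth B hB hBF hB'
  rw [abs_le]
  constructor <;> linarith [hA2.1, hA2.2, hB2.1, hB2.2]

lemma exists_gF (n : ℕ) (f : ℝ → ℝ) (B : Finset ℝ) (hB : B.card = n) (F : Finset ℝ) :
    ∃ g : ℝ → ℝ, (∀ S, S.card = n + 1 → Cons F S → dd g S = max (dd f S) 0) ∧
      ∀ y ∈ B, g y = 0 := by
  obtain ⟨g, hg⟩ := exists_cons n (fun S => max (dd f S) 0) F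
  have hinj : Set.InjOn (id : ℝ → ℝ) B := Function.injective_id.injOn
  refine ⟨fun x => g x - (Lagrange.interpolate B id g).eval x, fun S hS hc => ?_, fun y hy => ?_⟩
  · rw [dd_sub, dd_poly _ n _ S hS, sub_zero, hg S hS hc]
    rw [← hB]
    exact Lagrange.degree_interpolate_lt _ hinj
  · have := Lagrange.eval_interpolate_at_node g hinj hy
    simp only [id] at this
    simp only [this, sub_self]

lemma pt_bound (H : Set ℝ) (hH : IsOpen H) (hc : H.OrdConnected) (n : ℕ) (hn : 1 ≤ n) (f : ℝ → ℝ)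
    (hV : ∀ a b : ℝ, a < b → Set.Icc a b ⊆ H →
        omegaVar (fun i : Fin n => fun t : ℝ => t ^ (i : ℕ)) f a b ≠ ⊤)
    (B : Finset ℝ) (hB : B.card = n) (hBH : (B : Set ℝ) ⊆ H) (t : ℝ) (ht : t ∈ H) :
    ∃ (C : ℝ) (F₀ : Finset ℝ), ∀ F, F₀ ⊆ F → ∀ g : ℝ → ℝ,
      (∀ S, S.card = n + 1 → Cons F S → dd g S = max (dd f S) 0) → (∀ y ∈ B, g y = 0) →
      |g t| ≤ C := by
  by_cases htB : t ∈ B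
  · exact ⟨0, ∅, fun F _ g _ h0 => by rw [h0 t htB, abs_zero]⟩
  set T := insert t B with hT
  have htT : t ∈ T := Finset.mem_insert_self _ _
  have hTne : T.Nonempty := ⟨t, htT⟩
  have hTH : ∀ y ∈ T, y ∈ H := by
    intro y hy
    rcases Finset.mem_insert.1 hy with rfl | h
    · exact ht
    · exact hBH h
  obtain ⟨P, hPc, hPH, hPa⟩ := exists_below H hH _ (hTH _ (T.min'_mem hTne)) 1
  obtain ⟨Q, hQc, hQH, hQb⟩ := exists_above H hH _ (hTH _ (T.max'_mem hTne)) 1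
  obtain ⟨a, rfl⟩ := Finset.card_eq_one.1 hPc
  obtain ⟨b, rfl⟩ := Finset.card_eq_one.1 hQc
  have haH : a ∈ H := hPH (by simp)
  have hbH : b ∈ H := hQH (by simp)
  have hTab : ∀ y ∈ T, a < y ∧ y < b := fun y hy =>
    ⟨(hPa a (by simp)).trans_le (T.min'_le y hy), (T.le_max' y hy).trans_lt (hQb b (by simp))⟩
  have hV' := hV a b ((hTab t htT).1.trans (hTab t htT).2) (hc.out haH hbH)
  obtain ⟨b₁, hb₁⟩ : B.Nonempty := Finset.card_pos.1 (by omega)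
  set A := T.erase b₁ with hAdef
  have hAT : A ⊆ T := Finset.erase_subset _ _
  have hBT : B ⊆ T := Finset.subset_insert _ _
  have hAc : A.card = n := by
    rw [hAdef, Finset.card_erase_of_mem (hBT hb₁), hT, Finset.card_insert_of_notMem htB, hB]; rfl
  have htA : t ∈ A := Finset.mem_erase.2 ⟨fun e => htB (e ▸ hb₁), htT⟩
  refine ⟨(omegaVar (fun i : Fin n => fun t : ℝ => t ^ (i : ℕ)) f a b).toReal *
    |∏ y ∈ A.erase t, (t - y)|, insert a (insert b T), fun F hF g hg h0 => ?_⟩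
  have hTF : T ⊆ F := fun y hy => hF (by simp [hy])
  have key := finite_bound n hn f g F hg a b (hF (by simp)) (hF (by simp)) hV' A B hAc hB
    (hAT.trans hTF) (hBT.trans hTF) (fun y hy => hTab y (hAT hy)) (fun y hy => hTab y (hBT hy))
  have e1 : dd g B = 0 := Finset.sum_eq_zero fun x hx => by rw [h0 x hx, zero_div]
  have e2 : dd g A = g t / ∏ y ∈ A.erase t, (t - y) := by
    rw [dd, Finset.sum_eq_single_of_mem t htA]
    intro x hx hxt
    have : x ∈ B := by
      rcases Finset.mem_insert.1 (hAT hx) with rfl | h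
      · exact absurd rfl hxt
      · exact h
    rw [h0 x this, zero_div]
  rw [e1, e2, sub_zero, abs_div, div_le_iff₀ (abs_pos.2 (dd_prod_ne A t))] at key
  exact key

lemma dd_tendsto {ι : Type*} (l : Filter ι) (G : ι → ℝ → ℝ) (g : ℝ → ℝ) (S : Finset ℝ)
    (h : ∀ x ∈ S, Filter.Tendsto (fun i => G i x) l (nhds (g x))) :
    Filter.Tendsto (fun i => dd (G i) S) l (nhds (dd g S)) :=
  tendsto_finsetSum _ fun x hx => (h x hx).div_const _

/-- Corollary 3 (Popoviciu): for the polynomial Chebyshev system `ω = (1, x, …, x^{n-1})` on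
an open interval `H`, a function `f : H → ℝ` is the difference of two `ω`-convex functions if
and only if the `ω`-variation `V^ω_{[a,b]}(f)` is finite for every subinterval `[a,b] ⊆ H`. -/
theorem difference_of_polynomially_convex_iff_finite_variation (H : Set ℝ)
    (hHopen : IsOpen H) (hHconn : H.OrdConnected) (n : ℕ) (hn : 2 ≤ n) (f : ℝ → ℝ) :
    (∃ g h : ℝ → ℝ,
        IsConvexWRT (fun i : Fin n => fun t : ℝ => t ^ (i : ℕ)) H g ∧
        IsConvexWRT (fun i : Fin n => fun t : ℝ => t ^ (i : ℕ)) H h ∧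
        ∀ t ∈ H, f t = g t - h t) ↔
      ∀ a b : ℝ, a < b → Set.Icc a b ⊆ H →
        omegaVar (fun i : Fin n => fun t : ℝ => t ^ (i : ℕ)) f a b ≠ ⊤ := by
  have hn1 : 1 ≤ n := by omega
  constructor
  · rintro ⟨g, h, hg, hh, hf⟩ a b hab hI
    rw [isConvex_iff] at hg hh
    obtain ⟨C₁, h₁⟩ := convex_bound H hHopen n g hg a b hab hI
    obtain ⟨C₂, h₂⟩ := convex_bound H hHopen n h hh a b hab hI
    refine ne_top_of_le_ne_top ENNReal.ofReal_ne_top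
      (omegaVar_le n hn1 f a b (C₁ + C₂) fun m X hnm hX h0 hl => ?_)
    refine le_trans ?_ (add_le_add (h₁ m X hnm hX h0 hl) (h₂ m X hnm hX h0 hl))
    rw [← Finset.sum_add_distrib]
    refine Finset.sum_le_sum fun i hi => ?_
    have hi' := Finset.mem_range.1 hi
    have e : ∀ j, j + n ≤ m + 1 →
        dd f (win X n j) = dd g (win X n j) - dd h (win X n j) := by
      intro j hj
      rw [← dd_sub]
      refine dd_congr fun y hy => hf y (hI ?_)
      have := win_sub_Icc hX hj hy
      rw [h0, hl] at this
      exact this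
    rw [e i (by omega), e (i + 1) (by omega)]
    refine le_trans (le_of_eq ?_) (abs_sub _ _)
    congr 1
    ring
  · intro hV
    rcases H.eq_empty_or_nonempty with rfl | ⟨c, hcH⟩
    · refine ⟨f, 0, ?_, ?_, by simp⟩
      · exact fun x hx => absurd (hx 0) (by simp)
      · exact fun x hx => absurd (hx 0) (by simp)
    obtain ⟨B, hB, hBH, -⟩ := exists_below H hHopen c hcH n
    choose G hG hG0 using exists_gF n f B hB
    set U : Ultrafilter (Finset ℝ) := Ultrafilter.of Filter.atTop with hU
    have hUle : (U : Filter (Finset ℝ)) ≤ Filter.atTop := Ultrafilter.of_le _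
    have hlim : ∀ t : ℝ, ∃ L : ℝ, t ∈ H → Filter.Tendsto (fun F => G F t) U (nhds L) := by
      intro t
      by_cases ht : t ∈ H
      · obtain ⟨C, F₀, hC⟩ := pt_bound H hHopen hHconn n hn1 f hV B hB hBH t ht
        have hev : ∀ᶠ F in (U : Filter (Finset ℝ)), G F t ∈ Set.Icc (-C) C :=
          hUle ((Filter.eventually_ge_atTop F₀).mono fun F hF =>
            abs_le.1 (hC F hF (G F) (hG F) (hG0 F)))
        obtain ⟨L, -, hL⟩ := (isCompact_Icc (a := -C) (b := C)).ultrafilter_le_nhds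
          (U.map fun F => G F t) (by
            rw [Filter.le_principal_iff]
            exact hev)
        exact ⟨L, fun _ => hL⟩
      · exact ⟨0, fun h => absurd h ht⟩
    choose g hg using hlim
    have hsubF : ∀ S : Finset ℝ, ∀ᶠ F in (U : Filter (Finset ℝ)), S ⊆ F := fun S =>
      hUle (Filter.eventually_ge_atTop S)
    refine ⟨g, fun x => g x - f x, ?_, ?_, fun t _ => by ring⟩
    · rw [isConvex_iff]
      intro S hS hSH
      refine ge_of_tendsto (dd_tendsto _ G g S fun x hx => hg x (hSH hx)) ?_
      filter_upwards [hsubF S] with F hF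
      exact nonneg_of_cons n hn1 (G F) F
        (fun S hS hc => by rw [hG F S hS hc]; exact le_max_right _ _) _ S hS hF rfl
    · rw [isConvex_iff]
      intro S hS hSH
      refine ge_of_tendsto (dd_tendsto _ (fun F x => G F x - f x) _ S
        fun x hx => (hg x (hSH hx)).sub_const _) ?_
      filter_upwards [hsubF S] with F hF
      exact nonneg_of_cons n hn1 (fun x => G F x - f x) F
        (fun S hS hc => by
          rw [dd_sub, hG F S hS hc]; exact sub_nonneg.2 (le_max_left _ _)) _ S hS hF rfl
end

section
/- Let n ∈ ℕ and let I ⊆ ℝ be an open interval whose length is at most π. Then the function ω : I → ℝ^{2n} given by ω(x) = (cos x, sin x, cos 2x, sin 2x, …, cos nx, sin nx) is a (2n)-dimensional positive Chebyshev system over I; that is, the 2n×2n determinant det(ω_i(x_j)) is positive for all x₁ < … < x_{2n} in I. -/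
open Complex in
lemma tc_sum_pairs (N : ℕ) (y : Fin N → ℂ) :
    ∑ i : Fin N, ∑ j ∈ Finset.Ioi i, (y i + y j) = ((N : ℂ) - 1) * ∑ i, y i := by
  induction N with
  | zero => simp
  | succ N ih =>
    rw [Fin.sum_univ_succ, Fin.sum_Ioi_zero]
    simp only [Fin.sum_Ioi_succ]
    rw [ih (fun i => y i.succ), Fin.sum_univ_succ, Finset.sum_add_distrib]
    simp
    ring

lemma tc_prod_const (n : ℕ) (c : ℂ) :
    ∏ i : Fin (2 * n + 1), ∏ _j ∈ Finset.Ioi i, c = c ^ (n * (2 * n + 1)) := by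
  have h : ∀ N : ℕ, (∏ i : Fin N, ∏ _j ∈ Finset.Ioi i, c) = c ^ (N * (N - 1) / 2) := by
    intro N
    induction N with
    | zero => simp
    | succ N ih =>
      rw [Fin.prod_univ_succ, Fin.prod_Ioi_zero]
      simp only [Fin.prod_Ioi_succ]
      rw [ih, Finset.prod_const, Finset.card_univ, Fintype.card_fin, ← pow_add]
      congr 1
      have := Nat.triangle_succ N
      omega
  rw [h]
  congr 1
  rw [show (2 * n + 1) * (2 * n + 1 - 1) = (n * (2 * n + 1)) * 2 by simp; ring]
  simp

noncomputable def tcG (i : ℕ) (x : ℝ) : ℝ :=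
  match i with
  | 0 => 1
  | i + 1 => if i % 2 = 0 then Real.cos (((i / 2 + 1 : ℕ) : ℝ) * x)
        else Real.sin (((i / 2 + 1 : ℕ) : ℝ) * x)

noncomputable def tcW (i : ℕ) (z : ℂ) : ℂ :=
  match i with
  | 0 => 1
  | i + 1 => if i % 2 = 0 then (z ^ (i / 2 + 1) + z⁻¹ ^ (i / 2 + 1)) / 2
        else (z ^ (i / 2 + 1) - z⁻¹ ^ (i / 2 + 1)) / (2 * Complex.I)

lemma tcG_eq (i : ℕ) (x : ℝ) : ((tcG i x : ℝ) : ℂ) = tcW i (Complex.exp (Complex.I * x)) := by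
  cases i with
  | zero => simp [tcG, tcW]
  | succ i =>
    simp only [tcG, tcW]
    rw [← Complex.exp_neg, ← Complex.exp_nat_mul, ← Complex.exp_nat_mul]
    split_ifs
    · rw [Complex.ofReal_cos, Complex.cos]
      push_cast
      congr 3 <;> ring_nf
    · rw [Complex.ofReal_sin, Complex.sin]
      push_cast
      have : ∀ a b : ℂ, (a - b) * Complex.I / 2 = (b - a) / (2 * Complex.I) := by
        intro a b
        field_simp
        rw [Complex.I_sq]; ring
      rw [this]
      congr 3 <;> ring_nf

lemma tc_B (n : ℕ) : ∃ B : Matrix (Fin (2 * n + 1)) (Fin (2 * n + 1)) ℂ,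
    B.det = (Complex.I / 2) ^ n ∧ ∀ z : ℂ, z ≠ 0 → ∀ i, ∑ k, B i k * z ^ (k : ℕ)
      = z ^ n * tcW i z := by
  induction n with
  | zero =>
    refine ⟨1, by simp, fun z hz i => ?_⟩
    have h0 : i = (0 : Fin 1) := Fin.fin_one_eq_zero i
    subst h0
    simp [tcW]
  | succ n ih =>
    obtain ⟨B, hB, hz⟩ := ih
    let Q : Matrix (Fin 2) (Fin 2) ℂ := !![1/2, 1/2; 1/(2*Complex.I), -1/(2*Complex.I)]
    let e : Fin (2 * n + 1) ⊕ Fin 2 ≃ Fin (2 * (n + 1) + 1) := finSumFinEquiv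
    let r : Equiv.Perm (Fin (2 * (n + 1) + 1)) := finRotate _
    let M : Matrix (Fin (2 * (n + 1) + 1)) (Fin (2 * (n + 1) + 1)) ℂ :=
      (Matrix.fromBlocks B 0 0 Q).submatrix e.symm e.symm
    refine ⟨M.submatrix id r.symm, ?_, ?_⟩
    · rw [Matrix.det_permute', Matrix.det_submatrix_equiv_self, Matrix.det_fromBlocks_zero₂₁, hB,
        Equiv.Perm.sign_symm, sign_finRotate]
      simp only [Q, Matrix.det_fin_two_of]
      have : (-1 : ℤˣ) ^ (2 * (n + 1) + 1 - 1) = 1 := by rw [Nat.add_sub_cancel, pow_mul]; simp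
      rw [this, pow_succ]
      have hI : (1 : ℂ) / 2 * (-1 / (2 * Complex.I)) - 1 / 2 * (1 / (2 * Complex.I)) = Complex.I / 2 := by
        field_simp
        rw [Complex.I_sq]; ring
      rw [hI]; simp
    · intro z hz0 i
      have h1 : ∀ k : Fin (2 * n + 1), ((r (e (Sum.inl k)) : Fin _) : ℕ) = k + 1 := by
        intro k
        simp only [r, e]
        rw [coe_finRotate_of_ne_last]
        · simp
        · intro h
          have := congrArg Fin.val h
          simp at this
          omega
      have h2 : ((r (e (Sum.inr 0)) : Fin _) : ℕ) = 2 * n + 2 := by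
        simp only [r, e]
        rw [coe_finRotate_of_ne_last]
        · simp
        · intro h
          have := congrArg Fin.val h
          simp at this
          omega
      have h3 : ((r (e (Sum.inr 1)) : Fin _) : ℕ) = 0 := by
        have : e (Sum.inr 1) = Fin.last _ := by
          ext; simp [e]; omega
        rw [this]
        simp [r]
      rw [← Equiv.sum_comp (e.trans r), Fintype.sum_sum_type, Fin.sum_univ_two]
      simp only [Equiv.trans_apply, h1, h2, h3, Matrix.submatrix_apply, Equiv.symm_apply_apply, id, M]
      obtain ⟨i, rfl⟩ := e.surjective i
      simp only [Equiv.symm_apply_apply]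
      rcases i with i | i
      · have := hz z hz0 i
        simp [e, pow_succ, ← mul_assoc, ← Finset.sum_mul, this]
        ring
      · fin_cases i
        · have hv : ((e (Sum.inr 0) : Fin _) : ℕ) = 2 * n + 1 := by simp [e]
          have hd : (2 * n) / 2 = n := by omega
          simp [Q, hv, tcW, hd]
          field_simp
          ring
        · have hv : ((e (Sum.inr 1) : Fin _) : ℕ) = (2 * n + 1) + 1 := by simp [e]
          have hd : (2 * n + 1) / 2 = n := by omega
          have hm : (2 * n + 1) % 2 = 1 := by omega
          simp [Q, hv, tcW, hd, hm]
          field_simp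
          rw [Complex.I_sq]
          ring

lemma tc_exp_sub (x y : ℝ) : Complex.exp (Complex.I * y) - Complex.exp (Complex.I * x)
    = (2 * Complex.I) * ((Real.sin ((y - x) / 2) : ℝ) : ℂ) * Complex.exp (Complex.I / 2 * (x + y)) := by
  rw [Complex.ofReal_sin, Complex.sin]
  have : ∀ a b c : ℂ, 2 * Complex.I * ((a - b) * Complex.I / 2) * c = b * c - a * c := by
    intro a b c
    linear_combination (a - b) * c * Complex.I_sq
  rw [this, ← Complex.exp_add, ← Complex.exp_add]
  push_cast
  congr 2 <;> ring

lemma tc_D (n : ℕ) (y : Fin (2 * n + 1) → ℝ) :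
    Matrix.det (Matrix.of fun i j : Fin (2 * n + 1) => tcG i (y j))
      = 4 ^ (n ^ 2) * ∏ i, ∏ j ∈ Finset.Ioi i, Real.sin ((y j - y i) / 2) := by
  obtain ⟨B, hB, hz⟩ := tc_B n
  let z : Fin (2 * n + 1) → ℂ := fun j => Complex.exp (Complex.I * y j)
  let W : Matrix (Fin (2 * n + 1)) (Fin (2 * n + 1)) ℂ := Matrix.of fun i j => ((tcG i (y j) : ℝ) : ℂ)
  have hW : ((Matrix.det (Matrix.of fun i j : Fin (2 * n + 1) => tcG i (y j)) : ℝ) : ℂ) = W.det := by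
    rw [← Complex.ofRealHom_eq_coe, RingHom.map_det]
    rfl
  have hmul : B * (Matrix.vandermonde z).transpose = W * Matrix.diagonal (fun j => z j ^ n) := by
    ext i j
    rw [Matrix.mul_diagonal, Matrix.mul_apply]
    simp only [Matrix.transpose_apply, Matrix.vandermonde_apply]
    rw [hz _ (Complex.exp_ne_zero _)]
    simp only [W, Matrix.of_apply, tcG_eq]
    ring
  have hdet := congrArg Matrix.det hmul
  rw [Matrix.det_mul, Matrix.det_mul, Matrix.det_transpose, Matrix.det_diagonal, hB,
    Matrix.det_vandermonde] at hdet
  simp only [z, tc_exp_sub, Finset.prod_mul_distrib, tc_prod_const] at hdet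
  simp only [← Complex.exp_sum, ← Finset.mul_sum, ← Complex.exp_nat_mul] at hdet
  rw [tc_sum_pairs] at hdet
  have hE : Complex.I / 2 * ((((2 * n + 1 : ℕ) : ℂ) - 1) * ∑ i, (y i : ℂ))
      = (n : ℂ) * (Complex.I * ∑ i, (y i : ℂ)) := by
    push_cast; ring
  rw [hE] at hdet
  have hC : (Complex.I / 2) ^ n * (2 * Complex.I) ^ (n * (2 * n + 1)) = 4 ^ (n ^ 2) := by
    have h1 : Complex.I / 2 * (2 * Complex.I) = -1 := by
      linear_combination Complex.I_sq
    have h2 : (2 * Complex.I) ^ 2 = -1 * 4 := by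
      linear_combination 4 * Complex.I_sq
    rw [show n * (2 * n + 1) = n + 2 * n ^ 2 by ring, pow_add, ← mul_assoc, ← mul_pow, h1, pow_mul,
      h2, mul_pow, ← mul_assoc, ← pow_add, Even.neg_one_pow, one_mul]
    rw [show n + n ^ 2 = n * (n + 1) by ring]
    exact Nat.even_mul_succ_self n
  have hne := Complex.exp_ne_zero ((n : ℂ) * (Complex.I * ∑ i, (y i : ℂ)))
  apply Complex.ofReal_injective
  rw [hW]
  apply mul_right_cancel₀ hne
  rw [← hdet]
  push_cast
  rw [← hC]
  ring

lemma tc_int (n : ℕ) (u : Fin (2 * n) → ℝ) (hu : ∀ j, |u j| < Real.pi / 2) :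
    0 < ∫ s in (-(Real.pi / 2))..(3 * Real.pi / 2), ∏ j, Real.sin ((u j - s) / 2) := by
  have hc : Continuous fun s : ℝ => ∏ j, Real.sin ((u j - s) / 2) := by fun_prop
  set f : ℝ → ℝ := fun s : ℝ => ∏ j, Real.sin ((u j - s) / 2) with hf
  rw [← intervalIntegral.integral_add_adjacent_intervals (b := Real.pi / 2)
    (hc.intervalIntegrable _ _) (hc.intervalIntegrable _ _)]
  have h2 : ∫ s in (Real.pi / 2)..(3 * Real.pi / 2), f s
      = ∫ s in (-(Real.pi / 2))..(Real.pi / 2), f (Real.pi - s) := by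
    rw [intervalIntegral.integral_comp_sub_left (fun s => f s)]
    congr 1 <;> ring
  have hc2 : Continuous fun s : ℝ => f (Real.pi - s) := by fun_prop
  rw [h2, ← intervalIntegral.integral_add (hc.intervalIntegrable _ _) (hc2.intervalIntegrable _ _)]
  apply intervalIntegral.intervalIntegral_pos_of_pos_on
  · exact (hc.add hc2).intervalIntegrable _ _
  · intro s hs
    have h3 : f (Real.pi - s) = ∏ j, Real.cos ((u j + s) / 2) := by
      have : ∀ j, Real.sin ((u j - (Real.pi - s)) / 2) = - Real.cos ((u j + s) / 2) := by
        intro j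
        rw [← Real.sin_sub_pi_div_two]
        congr 1; ring
      simp only [hf, this, Finset.prod_neg]
      simp
    rw [h3]
    have hpos : ∀ j, 0 < Real.cos ((u j + s) / 2) := by
      intro j
      have := abs_lt.1 (hu j)
      apply Real.cos_pos_of_mem_Ioo
      constructor <;> linarith [hs.1, hs.2]
    have hlt : ∀ j, |Real.sin ((u j - s) / 2)| < Real.cos ((u j + s) / 2) := by
      intro j
      apply abs_lt_of_sq_lt_sq _ (hpos j).le
      have h4 : 0 < Real.cos (u j) * Real.cos s := by
        apply mul_pos
        · exact Real.cos_pos_of_mem_Ioo (abs_lt.1 (hu j))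
        · exact Real.cos_pos_of_mem_Ioo hs
      have h5 := Real.cos_sq ((u j + s) / 2)
      have h6 := Real.sin_sq ((u j - s) / 2)
      have h7 := Real.cos_sq ((u j - s) / 2)
      rw [show 2 * ((u j + s) / 2) = u j + s by ring, Real.cos_add] at h5
      rw [show 2 * ((u j - s) / 2) = u j - s by ring, Real.cos_sub] at h7
      linarith
    rcases Nat.eq_zero_or_pos n with rfl | hn
    · simp [hf]
    · have : |f s| < ∏ j, Real.cos ((u j + s) / 2) := by
        simp only [hf, Finset.abs_prod]
        have : Nonempty (Fin (2 * n)) := ⟨⟨0, by omega⟩⟩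
        by_cases h0 : ∃ j, Real.sin ((u j - s) / 2) = 0
        · obtain ⟨j, hj⟩ := h0
          rw [Finset.prod_eq_zero (Finset.mem_univ j) (by simp [hj])]
          exact Finset.prod_pos fun j _ => hpos j
        · push Not at h0
          exact Finset.prod_lt_prod_of_nonempty (fun j _ => abs_pos.2 (h0 j)) (fun j _ => hlt j)
            Finset.univ_nonempty
      linarith [(abs_lt.1 this).1]
  · linarith [Real.pi_pos]

lemma tc_int_zero (i : ℕ) (c : ℝ) :
    ∫ s in (-(Real.pi / 2))..(3 * Real.pi / 2), tcG (i + 1) (s + c) = 0 := by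
  simp only [tcG]
  set m := i / 2 + 1 with hm
  have hm0 : (m : ℝ) ≠ 0 := by positivity
  have e : (m : ℝ) * (3 * Real.pi / 2) + m * c
    = ((m : ℝ) * (-(Real.pi / 2)) + m * c) + m * (2 * Real.pi) := by ring
  split_ifs
  · simp only [mul_add]
    rw [intervalIntegral.integral_comp_mul_add (fun x => Real.cos x) hm0, integral_cos, e,
      Real.sin_add_nat_mul_two_pi]
    simp
  · simp only [mul_add]
    rw [intervalIntegral.integral_comp_mul_add (fun x => Real.sin x) hm0, integral_sin, e,
      Real.cos_add_nat_mul_two_pi]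
    simp

lemma tcG_cont (i : ℕ) : Continuous (tcG i) := by
  cases i with
  | zero => exact continuous_const
  | succ i =>
    unfold tcG
    dsimp only
    split_ifs <;> fun_prop

/-- The function `ω(x) = (cos x, sin x, …, cos nx, sin nx)` is a `2n`-dimensional positive
Chebyshev system over any open interval of length at most `π`. -/
theorem trig_chebyshev_even (n : ℕ) (a b : ℝ) (hab : b - a ≤ Real.pi) :
    IsPosChebyshev
      (fun i : Fin (2 * n) => fun x : ℝ =>
        if (i : ℕ) % 2 = 0 then Real.cos ((((i : ℕ) / 2 + 1 : ℕ) : ℝ) * x)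
        else Real.sin ((((i : ℕ) / 2 + 1 : ℕ) : ℝ) * x))
      (Set.Ioo a b) := by
  intro x hx hmono
  set P := Phi (fun i : Fin (2 * n) => fun x : ℝ =>
        if (i : ℕ) % 2 = 0 then Real.cos ((((i : ℕ) / 2 + 1 : ℕ) : ℝ) * x)
        else Real.sin ((((i : ℕ) / 2 + 1 : ℕ) : ℝ) * x)) x with hP
  have hP' : P = Matrix.det (Matrix.of fun i j : Fin (2 * n) => tcG ((i : ℕ) + 1) (x j)) := rfl
  clear_value P
  let c := (a + b) / 2
  let A : Fin (2 * n + 1) → ℝ := fun i => (-1) ^ (i : ℕ) *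
    Matrix.det (Matrix.of fun k j : Fin (2 * n) => tcG (i.succAbove k : Fin (2 * n + 1)) (x j))
  have hA0 : A 0 = P := by simp [A, hP']
  have hS : (0 : ℝ) < ∏ i, ∏ j ∈ Finset.Ioi i, Real.sin ((x j - x i) / 2) := by
    refine Finset.prod_pos fun i _ => Finset.prod_pos fun j hj => ?_
    have h1 := hmono (Finset.mem_Ioi.1 hj)
    have h2 := (hx j).2
    have h3 := (hx i).1
    exact Real.sin_pos_of_pos_of_lt_pi (by linarith) (by linarith)
  have key : ∀ s : ℝ, ∑ i : Fin (2 * n + 1), A i * tcG i (s + c)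
      = 4 ^ (n ^ 2) * (∏ i, ∏ j ∈ Finset.Ioi i, Real.sin ((x j - x i) / 2)) *
        ∏ j, Real.sin (((x j - c) - s) / 2) := by
    intro s
    have := tc_D n (Fin.cons (s + c) x)
    rw [Matrix.det_succ_column_zero, Fin.prod_univ_succ, Fin.prod_Ioi_zero] at this
    simp only [Fin.prod_Ioi_succ, Fin.cons_succ, Fin.cons_zero, Matrix.of_apply] at this
    have e : ∀ j, x j - c - s = x j - (s + c) := fun j => by ring
    simp only [e]
    rw [mul_assoc, mul_comm (∏ i, ∏ j ∈ Finset.Ioi i, Real.sin ((x j - x i) / 2)), ← this]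
    refine Finset.sum_congr rfl fun i _ => ?_
    simp only [A]
    rw [mul_right_comm]
    rfl
  have hint : ∫ s in (-(Real.pi / 2))..(3 * Real.pi / 2), ∑ i : Fin (2 * n + 1), A i * tcG i (s + c)
      = P * (2 * Real.pi) := by
    rw [intervalIntegral.integral_finset_sum]
    · simp only [intervalIntegral.integral_const_mul]
      rw [Fin.sum_univ_succ]
      simp only [Fin.val_succ, tc_int_zero, hA0]
      simp [tcG]
      left; ring
    · intro i _
      exact (continuous_const.mul ((tcG_cont i).comp (by fun_prop))).intervalIntegrable _ _
  simp only [key, intervalIntegral.integral_const_mul] at hint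
  have hI := tc_int n (fun j => x j - c) (fun j => by
    have := hx j
    simp only [c]
    rw [abs_lt]
    constructor <;> linarith [this.1, this.2])
  have : 0 < P * (2 * Real.pi) := by
    rw [← hint]; positivity
  exact pos_of_mul_pos_left this (by positivity)
end
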